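/- Let f : I → ℝ be a bounded measurable function on a nontrivial compact interval I and let m ≥ 1 be such that supp(f^(m)) ≠ ∅. Then for every h ≥ 0, dim_H E^(m)_f(h) ≤ (τ^(m)_f)^*(h) = inf_{q∈ℝ}(hq − τ^(m)_f(q)), a negative right-hand side meaning that E^(m)_f(h) is empty. Moreover dim_H supp(f^(m)) ≤ upper box dimension of supp(f^(m)) = −τ^(m)_f(0). -/

import Mathlib

open Filter Set Metric Topology MeasureTheory
open scoped ENNReal NNReal
noncomputable section

/-- Iterated finite difference: `deltaIter f h m` is `Δ_h^m f`. -/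
def deltaIter (f : ℝ → ℝ) (h : ℝ) : ℕ → ℝ → ℝ
  | 0 => f
  | (m+1) => fun t => deltaIter f h m (t + h) - deltaIter f h m t

/-- `m`-th order oscillation of `f` over a set `J`. -/
def osc (f : ℝ → ℝ) (m : ℕ) (J : Set ℝ) : ℝ :=
  sSup {x : ℝ | ∃ t h : ℝ, 0 ≤ h ∧ Icc t (t + m * h) ⊆ J ∧ x = |deltaIter f h m t|}

/-- Support of the `m`-th distributional derivative of `f` on `I`. -/
def suppDeriv (f : ℝ → ℝ) (I : Set ℝ) (m : ℕ) : Set ℝ :=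
  {t ∈ I | ∀ a c : ℝ, a < t → t < c →
    ¬ ∃ P : Polynomial ℝ, P.degree < (m : WithBot ℕ) ∧ ∀ s ∈ I ∩ Ioo a c, f s = P.eval s}

/-- Pointwise `m`-th order oscillation exponent. -/
def oscExp (f : ℝ → ℝ) (m : ℕ) (I : Set ℝ) (t : ℝ) : EReal :=
  liminf (fun r : ℝ => ((Real.log (osc f m (ball t r ∩ I)) / Real.log r : ℝ) : EReal))
    (𝓝[>] (0:ℝ))

/-- `x ^ q` with the convention `0 ^ q = 0`. -/
def oscPow (x q : ℝ) : ℝ := if x = 0 then 0 else x ^ q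

/-- Supremum of `Σ_i Osc^{(m)}_f(B_i ∩ I)^q` over all families of disjoint closed intervals
of radius `r` with centers in `supp(f^{(m)})`. -/
def packSup (f : ℝ → ℝ) (m : ℕ) (I : Set ℝ) (q r : ℝ) : ℝ :=
  sSup {x : ℝ | ∃ S : Finset ℝ, (↑S : Set ℝ) ⊆ suppDeriv f I m ∧
    (↑S : Set ℝ).Pairwise (fun c c' => Disjoint (closedBall c r) (closedBall c' r)) ∧
    x = ∑ c ∈ S, oscPow (osc f m (closedBall c r ∩ I)) q}

/-- `L^q`-spectrum of `f` associated with oscillations of order `m`. -/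
def tauSpec (f : ℝ → ℝ) (m : ℕ) (I : Set ℝ) (q : ℝ) : EReal :=
  liminf (fun r : ℝ => ((Real.log (packSup f m I q r) / Real.log r : ℝ) : EReal)) (𝓝[>] (0:ℝ))

/-- Legendre transform `τ^*(h) = inf_{q ∈ ℝ} (hq - τ(q))`. -/
def legendre (τ : ℝ → EReal) (h : ℝ) : EReal := ⨅ q : ℝ, ((h * q : ℝ) : EReal) - τ q

/-- Hausdorff dimension with the convention `dim_H ∅ = -∞`. -/
def dimHE (E : Set ℝ) : EReal :=
  @ite _ (E = ∅) (Classical.dec _) ⊥ ((dimH E : ℝ≥0∞) : EReal)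

/-- Minimal number of open balls of radius `r` needed to cover `K`. -/
def coverNum (K : Set ℝ) (r : ℝ) : ℕ :=
  sInf {n : ℕ | ∃ S : Finset ℝ, S.card = n ∧ K ⊆ ⋃ c ∈ S, ball c r}

/-- Upper box (Minkowski) dimension. -/
def upperBoxDim (K : Set ℝ) : EReal :=
  limsup (fun r : ℝ => ((Real.log (coverNum K r) / Real.log (1 / r) : ℝ) : EReal)) (𝓝[>] (0:ℝ))


lemma deltaIter_eq_fwd (f : ℝ → ℝ) (h : ℝ) (m : ℕ) : deltaIter f h m = (fwdDiff h)^[m] f := by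
  induction m with
  | zero => rfl
  | succ n ih =>
    rw [Function.iterate_succ_apply', ← ih]
    rfl

def coefD (m k : ℕ) : ℝ := (-1) ^ (m - k) * (m.choose k : ℝ)

lemma deltaIter_sum (f : ℝ → ℝ) (h : ℝ) (m : ℕ) (t : ℝ) :
    deltaIter f h m t = ∑ k ∈ Finset.range (m + 1), coefD m k * f (t + k * h) := by
  rw [deltaIter_eq_fwd, fwdDiff_iter_eq_sum_shift]
  refine Finset.sum_congr rfl fun k _ => ?_
  simp [coefD, zsmul_eq_mul]

lemma coefD_self (m : ℕ) : coefD m m = 1 := by simp [coefD]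

lemma coefD_zero_ne (m : ℕ) : coefD m 0 ≠ 0 := by simp [coefD]

lemma deltaIter_poly (P : Polynomial ℝ) (m : ℕ) (hm : 1 ≤ m) (hP : P.degree < (m : WithBot ℕ))
    (h t : ℝ) : deltaIter (fun x => P.eval x) h m t = 0 := by
  have hnd : P.natDegree < m := by
    by_cases h0 : P = 0
    · subst h0; rw [Polynomial.natDegree_zero]; omega
    · exact (Polynomial.natDegree_lt_iff_degree_lt h0).2 hP
  set Q : Polynomial ℝ := P.comp (Polynomial.C t + Polynomial.C h * Polynomial.X) with hQ
  have hQd : Q.natDegree < m := by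
    refine lt_of_le_of_lt (Polynomial.natDegree_comp_le) ?_
    have : (Polynomial.C t + Polynomial.C h * Polynomial.X : Polynomial ℝ).natDegree ≤ 1 := by
      compute_degree
    nlinarith
  have := congrFun (Polynomial.fwdDiff_iter_eq_zero_of_degree_lt hQd) 0
  rw [← deltaIter_eq_fwd, deltaIter_sum] at this
  rw [deltaIter_sum]
  simp only [hQ, Polynomial.eval_comp, Polynomial.eval_add, Polynomial.eval_mul, Polynomial.eval_C,
    Polynomial.eval_X, Pi.zero_apply] at this
  rw [← this]
  refine Finset.sum_congr rfl fun k _ => ?_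
  ring_nf

lemma abs_deltaIter_le (f : ℝ → ℝ) (C : ℝ) (h : ℝ) (hh : 0 ≤ h) (J : Set ℝ)
    (hC : ∀ t ∈ J, |f t| ≤ C) (m : ℕ) (t : ℝ) (hJ : Icc t (t + m * h) ⊆ J) :
    |deltaIter f h m t| ≤ 2 ^ m * C := by
  induction m generalizing t with
  | zero => simpa [deltaIter] using hC t (hJ (by simp))
  | succ n ih =>
    have h1 := ih (t + h) (fun x hx => hJ ⟨by linarith [hx.1], by push_cast; linarith [hx.2]⟩)
    have h2 := ih t (fun x hx => hJ ⟨hx.1, by push_cast; linarith [hx.2]⟩)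
    simp only [deltaIter]
    calc _ ≤ _ := abs_sub _ _
      _ ≤ 2 ^ n * C + 2 ^ n * C := add_le_add h1 h2
      _ = _ := by ring

/-- continuity from vanishing of differences -/
lemma frechet_cont (u v : ℝ) (f : ℝ → ℝ) (hmeas : Measurable f) (C : ℝ)
    (hC : ∀ t ∈ Icc u v, |f t| ≤ C) (m : ℕ)
    (hz : ∀ t h : ℝ, 0 ≤ h → u ≤ t → t + m * h ≤ v → deltaIter f h m t = 0) :
    ContinuousOn f (Ioo u v) := by
  intro t₀ ht₀
  apply ContinuousAt.continuousWithinAt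
  set g : ℝ → ℝ := (Icc u v).indicator f with hg
  have hgm : Measurable g := hmeas.indicator measurableSet_Icc
  have hgint : Integrable g := by
    rw [hg, integrable_indicator_iff measurableSet_Icc]
    refine Measure.integrableOn_of_bounded (M := C) (by simp) hmeas.aestronglyMeasurable ?_
    rw [ae_restrict_iff' measurableSet_Icc]
    exact ae_of_all _ fun x hx => by simpa using hC x hx
  have hgii : ∀ a b, IntervalIntegrable g volume a b := fun a b => hgint.intervalIntegrable
  set G : ℝ → ℝ := fun b => ∫ x in (0:ℝ)..b, g x with hG
  have hGc : Continuous G := intervalIntegral.continuous_primitive hgii 0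
  obtain ⟨w, hw1, hw2⟩ := exists_between ht₀.2
  set η : ℝ := (v - w) / (m + 1) with hη
  have hm0 : (0:ℝ) < m + 1 := by positivity
  have hηpos : 0 < η := div_pos (by linarith) hm0
  have hηm : m * η ≤ v - w := by
    rw [hη, ← mul_div_assoc, div_le_iff₀ hm0]; nlinarith
  set F : ℝ → ℝ := fun t => -(coefD m 0 * η)⁻¹ * ∑ k ∈ Finset.range m,
    coefD m (k+1) * (((k:ℝ)+1)⁻¹ * (G (t + (k+1) * η) - G t)) with hF
  have hFc : Continuous F := by
    simp only [hF]
    fun_prop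
  have heq : ∀ t ∈ Ioo u w, f t = F t := by
    intro t ht
    have key : ∀ h ∈ Icc (0:ℝ) η, coefD m 0 * f t
        + ∑ k ∈ Finset.range m, coefD m (k+1) * g (t + (k+1) * h) = 0 := by
      intro h hh
      have h1 := hz t h hh.1 ht.1.le (by
        have : m * h ≤ m * η := by gcongr; exact hh.2
        linarith [ht.2])
      rw [deltaIter_sum, Finset.sum_range_succ'] at h1
      rw [add_comm, ← h1]
      congr 1
      · refine Finset.sum_congr rfl fun k hk => ?_
        have hkm : ((k:ℝ)+1) ≤ m := by exact_mod_cast Finset.mem_range.1 hk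
        have : t + (k+1) * h ∈ Icc u v := by
          constructor
          · have : 0 ≤ ((k:ℝ)+1) * h := mul_nonneg (by positivity) hh.1
            linarith [ht.1]
          · have : ((k:ℝ)+1) * h ≤ m * η := mul_le_mul hkm hh.2 hh.1 (by positivity)
            linarith [ht.2]
        rw [hg, indicator_of_mem this]
        push_cast; rfl
      · simp
    have hcomp : ∀ k : ℕ, IntervalIntegrable (fun h => coefD m (k+1) * g (t + (k+1) * h)) volume 0 η := by
      intro k
      apply IntervalIntegrable.const_mul
      have hk : ((k:ℝ)+1) ≠ 0 := by positivity
      exact ((hgint.comp_add_left t).comp_mul_left' hk).intervalIntegrable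
    have hint : ∫ h in (0:ℝ)..η, (coefD m 0 * f t
        + ∑ k ∈ Finset.range m, coefD m (k+1) * g (t + (k+1) * h)) = 0 := by
      rw [intervalIntegral.integral_congr (g := fun _ => (0:ℝ))]
      · simp
      · intro h hh
        rw [uIcc_of_le hηpos.le] at hh
        exact key h hh
    have hsumint : IntervalIntegrable
        (fun h => ∑ k ∈ Finset.range m, coefD m (k+1) * g (t + (k+1) * h)) volume 0 η := by
      have := IntervalIntegrable.sum (Finset.range m) (fun k _ => hcomp k)
      refine this.congr ?_
      intro x _
      simp [Finset.sum_apply]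
    rw [intervalIntegral.integral_add intervalIntegrable_const hsumint,
      intervalIntegral.integral_finsetSum fun k _ => hcomp k] at hint
    have hterm : ∀ k : ℕ, ∫ h in (0:ℝ)..η, coefD m (k+1) * g (t + (k+1) * h)
        = coefD m (k+1) * (((k:ℝ)+1)⁻¹ * (G (t + (k+1) * η) - G t)) := by
      intro k
      have hk : ((k:ℝ)+1) ≠ 0 := by positivity
      rw [intervalIntegral.integral_const_mul, intervalIntegral.integral_comp_add_mul _ hk]
      simp only [hG, smul_eq_mul, mul_zero, add_zero]
      rw [intervalIntegral.integral_interval_sub_left (hgii _ _) (hgii _ _)]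
    simp only [hterm, intervalIntegral.integral_const, sub_zero, smul_eq_mul] at hint
    simp only [hF]
    have hc := coefD_zero_ne m
    generalize (∑ x ∈ Finset.range m, coefD m (x + 1) *
      (((x:ℝ) + 1)⁻¹ * (G (t + ((x:ℝ) + 1) * η) - G t))) = Z at hint ⊢
    field_simp
    linarith
  have : f =ᶠ[𝓝 t₀] F := by
    filter_upwards [Ioo_mem_nhds ht₀.1 hw1] with t ht using heq t ht
  exact (continuousAt_congr this).2 hFc.continuousAt

lemma frechet_grid (u v : ℝ) (huv : u < v) (f : ℝ → ℝ) (m : ℕ) (hm : 1 ≤ m)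
    (hz : ∀ t h : ℝ, 0 ≤ h → u ≤ t → t + m * h ≤ v → deltaIter f h m t = 0) (N : ℕ) (hN : 1 ≤ N) :
    ∃ P : Polynomial ℝ, P.degree < (m : WithBot ℕ) ∧
      ∀ k : ℕ, k ≤ N → f (u + k * ((v - u) / N)) = P.eval (u + k * ((v - u) / N)) := by
  have hN0 : (0:ℝ) < N := by exact_mod_cast hN
  set η := (v - u) / N with hη
  have hηpos : 0 < η := div_pos (by linarith) hN0
  have hNη : N * η = v - u := by rw [hη]; field_simp
  set p : ℕ → ℝ := fun k => u + k * η with hp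
  have hinj : Set.InjOn p (Finset.range m) := by
    intro a _ b _ hab
    simp only [hp, add_right_inj, mul_eq_mul_right_iff, Nat.cast_inj, hηpos.ne', or_false] at hab
    exact hab
  set P := Lagrange.interpolate (Finset.range m) p (fun k => f (p k)) with hPdef
  have hPd : P.degree < (m : WithBot ℕ) := by
    have := Lagrange.degree_interpolate_lt (fun k => f (p k)) hinj
    rwa [Finset.card_range] at this
  refine ⟨P, hPd, fun k => ?_⟩
  induction k using Nat.strong_induction_on with
  | _ k ih =>
    intro hk
    by_cases hkm : k < m
    · exact (Lagrange.eval_interpolate_at_node (fun k => f (p k)) hinj (Finset.mem_range.2 hkm)).symm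
    · obtain ⟨j, rfl⟩ := Nat.exists_eq_add_of_le (not_lt.1 hkm)
      have hj : (0:ℝ) ≤ j := by positivity
      have h1 := hz (u + j * η) η hηpos.le (by nlinarith) (by
        have : ((m + j : ℕ) : ℝ) ≤ N := by exact_mod_cast hk
        push_cast at this
        nlinarith)
      have h2 := deltaIter_poly P m hm hPd η (u + j * η)
      rw [deltaIter_sum, Finset.sum_range_succ, coefD_self] at h1 h2
      have h3 : ∑ k ∈ Finset.range m, coefD m k * f (u + j * η + k * η)
          = ∑ k ∈ Finset.range m, coefD m k * P.eval (u + j * η + k * η) := by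
        refine Finset.sum_congr rfl fun i hi => ?_
        have hi' := Finset.mem_range.1 hi
        have := ih (i + j) (by omega) (by omega)
        have e : u + j * η + i * η = u + ((i + j : ℕ) : ℝ) * η := by push_cast; ring
        rw [e, this]
      have e : u + ((m + j : ℕ) : ℝ) * η = u + j * η + m * η := by push_cast; ring
      rw [e]
      linarith

lemma frechet (u v : ℝ) (huv : u < v) (f : ℝ → ℝ) (hmeas : Measurable f) (C : ℝ)
    (hC : ∀ t ∈ Icc u v, |f t| ≤ C) (m : ℕ) (hm : 1 ≤ m)
    (hz : ∀ t h : ℝ, 0 ≤ h → u ≤ t → t + m * h ≤ v → deltaIter f h m t = 0) :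
    ∃ P : Polynomial ℝ, P.degree < (m : WithBot ℕ) ∧ ∀ s ∈ Icc u v, f s = P.eval s := by
  obtain ⟨P, hPd, hP⟩ := frechet_grid u v huv f m hm hz m hm
  have hm0 : (0:ℝ) < m := by exact_mod_cast hm
  have hgrid : ∀ n : ℕ, 1 ≤ n → ∀ k : ℕ, k ≤ n →
      f (u + k * ((v - u) / n)) = P.eval (u + k * ((v - u) / n)) := by
    intro n hn k hk
    have hn0 : (0:ℝ) < n := by exact_mod_cast hn
    obtain ⟨Q, hQd, hQ⟩ := frechet_grid u v huv f m hm hz (n * m) (Nat.mul_pos hn hm)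
    have hQP : Q = P := by
      refine Polynomial.eq_of_degrees_lt_of_eval_index_eq (Finset.range m)
        (v := fun k : ℕ => u + k * ((v - u) / m)) ?_ (by simpa using hQd) (by simpa using hPd) ?_
      · intro a _ b _ hab
        have : (v - u) / m ≠ 0 := (div_pos (by linarith) hm0).ne'
        simp only [add_right_inj, mul_eq_mul_right_iff, Nat.cast_inj, this, or_false] at hab
        exact hab
      · intro i hi
        have hi' := Finset.mem_range.1 hi
        have h1 := hP i hi'.le
        have h2 := hQ (n * i) (Nat.mul_le_mul_left _ hi'.le)
        have e : u + ((n * i : ℕ) : ℝ) * ((v - u) / ((n * m : ℕ) : ℝ)) = u + i * ((v - u) / m) := by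
          push_cast; field_simp
        rw [e] at h2
        rw [← h1, ← h2]
    have h2 := hQ (k * m) (Nat.mul_le_mul_right _ hk)
    have e : u + ((k * m : ℕ) : ℝ) * ((v - u) / ((n * m : ℕ) : ℝ)) = u + k * ((v - u) / n) := by
      push_cast; field_simp
    rw [e, hQP] at h2
    exact h2
  have hcont := frechet_cont u v f hmeas C hC m hz
  refine ⟨P, hPd, fun s hs => ?_⟩
  rcases eq_or_lt_of_le hs.1 with h | h
  · have := hgrid 1 le_rfl 0 (by norm_num)
    rw [← h]; simpa using this
  rcases eq_or_lt_of_le hs.2 with h' | h'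
  · have := hgrid 1 le_rfl 1 (by norm_num)
    rw [h']; simpa using this
  have hcl : ContinuousAt (fun x => f x - P.eval x) s :=
    ((hcont s ⟨h, h'⟩).continuousAt (Ioo_mem_nhds h h')).sub P.continuous.continuousAt
  have hfr : ∃ᶠ x in 𝓝 s, f x - P.eval x = 0 := by
    rw [frequently_nhds_iff]
    intro U hsU hU
    obtain ⟨ε, hε, hball⟩ := Metric.isOpen_iff.1 (hU.inter isOpen_Ioo) s ⟨hsU, h, h'⟩
    have hvu : 0 < v - u := by linarith
    obtain ⟨q, hq1, hq2⟩ := exists_rat_btwn (show (s - u) / (v - u) < (s + ε - u) / (v - u) by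
      gcongr; linarith)
    rw [div_lt_iff₀ hvu] at hq1
    rw [lt_div_iff₀ hvu] at hq2
    have hmem : u + q * (v - u) ∈ ball s ε := by
      rw [Real.ball_eq_Ioo]; constructor <;> linarith
    have hx := hball hmem
    have hq0 : (0:ℝ) ≤ q := by
      have := hx.2.1
      by_contra hneg
      push Not at hneg
      nlinarith
    have hq1' : (q:ℝ) ≤ 1 := by
      have := hx.2.2
      by_contra hneg
      push Not at hneg
      nlinarith
    have hq0' : (0:ℚ) ≤ q := by exact_mod_cast hq0
    have hqe : (q:ℝ) = (q.num.toNat : ℝ) / q.den := by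
      have h1 : ((q.num.toNat : ℤ)) = q.num := Int.toNat_of_nonneg (Rat.num_nonneg.2 hq0')
      have h2 : ((q.num.toNat : ℝ)) = (q.num : ℝ) := by exact_mod_cast congrArg (Int.cast : ℤ → ℝ) h1
      rw [h2]
      exact Rat.cast_def q
    have hden : (0:ℝ) < q.den := by exact_mod_cast q.den_pos
    refine ⟨_, hx.1, ?_⟩
    have := hgrid q.den q.den_pos q.num.toNat (by
      rw [hqe, div_le_one hden] at hq1'
      exact_mod_cast hq1')
    have e : u + (q.num.toNat : ℝ) * ((v - u) / q.den) = u + q * (v - u) := by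
      rw [hqe]; ring
    rw [e] at this
    rw [this, sub_self]
  by_contra hne
  have : ∀ᶠ x in 𝓝 s, f x - P.eval x ≠ 0 := hcl.eventually_ne (sub_ne_zero.2 hne)
  exact hfr this


lemma osc_nonneg (f : ℝ → ℝ) (m : ℕ) (J : Set ℝ) : 0 ≤ osc f m J := by
  apply Real.sSup_nonneg
  rintro x ⟨t, h, -, -, rfl⟩
  exact abs_nonneg _

lemma osc_bdd (f : ℝ → ℝ) (m : ℕ) (J : Set ℝ) (C : ℝ) (hC : ∀ t ∈ J, |f t| ≤ C) :
    BddAbove {x : ℝ | ∃ t h : ℝ, 0 ≤ h ∧ Icc t (t + m * h) ⊆ J ∧ x = |deltaIter f h m t|} := by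
  refine ⟨2 ^ m * C, ?_⟩
  rintro x ⟨t, h, h0, hJ, rfl⟩
  exact abs_deltaIter_le f C h h0 J hC m t hJ

lemma osc_mono (f : ℝ → ℝ) (m : ℕ) (J J' : Set ℝ) (C : ℝ) (hC : ∀ t ∈ J', |f t| ≤ C)
    (hJJ : J ⊆ J') : osc f m J ≤ osc f m J' := by
  refine Real.sSup_le ?_ (osc_nonneg f m J')
  rintro x ⟨t, h, h0, hJ, rfl⟩
  exact le_csSup (osc_bdd f m J' C hC) ⟨t, h, h0, hJ.trans hJJ, rfl⟩

lemma osc_le (f : ℝ → ℝ) (m : ℕ) (J : Set ℝ) (C : ℝ) (hC0 : 0 ≤ C) (hC : ∀ t ∈ J, |f t| ≤ C) :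
    osc f m J ≤ 2 ^ m * C := by
  refine Real.sSup_le ?_ (by positivity)
  rintro x ⟨t, h, h0, hJ, rfl⟩
  exact abs_deltaIter_le f C h h0 J hC m t hJ

lemma osc_pos (A B : ℝ) (hAB : A < B) (f : ℝ → ℝ) (hmeas : Measurable f)
    (C : ℝ) (hC : ∀ t ∈ Icc A B, |f t| ≤ C) (m : ℕ) (hm : 1 ≤ m) (t : ℝ)
    (ht : t ∈ suppDeriv f (Icc A B) m) (r : ℝ) (hr : 0 < r) :
    0 < osc f m (ball t r ∩ Icc A B) := by
  refine lt_of_le_of_ne (osc_nonneg _ _ _) fun h0 => ?_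
  obtain ⟨⟨htA, htB⟩, hK⟩ := ht
  apply hK (t - r/2) (t + r/2) (by linarith) (by linarith)
  have hsub : Icc (max A (t - r/2)) (min B (t + r/2)) ⊆ ball t r ∩ Icc A B := by
    rintro x ⟨h1, h2⟩
    rw [max_le_iff] at h1
    rw [le_min_iff] at h2
    refine ⟨?_, h1.1, h2.1⟩
    rw [Real.ball_eq_Ioo]
    constructor <;> linarith [h1.2, h2.2]
  obtain ⟨P, hPd, hP⟩ := frechet (max A (t - r/2)) (min B (t + r/2))
    (by rw [max_lt_iff, lt_min_iff, lt_min_iff]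
        refine ⟨⟨hAB, by linarith⟩, by linarith, by linarith⟩)
    f hmeas C (fun x hx => hC x (hsub hx).2) m hm (by
      intro s h hh hs1 hs2
      have : |deltaIter f h m s| ≤ osc f m (ball t r ∩ Icc A B) :=
        le_csSup (osc_bdd f m _ C (fun x hx => hC x hx.2)) ⟨s, h, hh,
          (Icc_subset_Icc hs1 hs2).trans hsub, rfl⟩
      rw [← h0] at this
      exact abs_nonpos_iff.1 this)
  refine ⟨P, hPd, fun s hs => hP s ?_⟩
  exact ⟨max_le hs.1.1 hs.2.1.le, le_min hs.1.2 hs.2.2.le⟩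

/-- packing relation -/
def Packing (S : Finset ℝ) (r : ℝ) : Prop :=
  (↑S : Set ℝ).Pairwise (fun c c' => Disjoint (closedBall c r) (closedBall c' r))

lemma packing_card_le (S T : Finset ℝ) (r : ℝ) (hS : Packing S r)
    (hT : (↑S : Set ℝ) ⊆ ⋃ c ∈ T, ball c r) : S.card ≤ T.card := by
  have h1 : ∀ x : ℝ, ∃ c, x ∈ S → c ∈ T ∧ x ∈ ball c r := by
    intro x
    by_cases hx : x ∈ S
    · have := hT hx
      simp only [mem_iUnion, exists_prop] at this
      obtain ⟨c, hc⟩ := this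
      exact ⟨c, fun _ => hc⟩
    · exact ⟨0, fun h => absurd h hx⟩
  choose g hg using h1
  refine Finset.card_le_card_of_injOn g (fun x hx => (hg x hx).1) ?_
  intro x hx y hy hxy
  by_contra hne
  have hd := hS hx hy hne
  have h2 := (hg x hx).2
  have h3 := (hg y hy).2
  rw [← hxy] at h3
  rw [mem_ball, dist_comm] at h2 h3
  exact Set.disjoint_left.1 hd (mem_closedBall.2 h2.le) (mem_closedBall.2 h3.le)

lemma exists_cover (A B r : ℝ) (hr : 0 < r) : ∃ T : Finset ℝ, Icc A B ⊆ ⋃ c ∈ T, ball c r := by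
  obtain ⟨T, -, hf, hT⟩ := (isCompact_Icc (a := A) (b := B)).finite_cover_balls hr
  exact ⟨hf.toFinset, by simpa using hT⟩

lemma exists_max_packing (A B r : ℝ) (hr : 0 < r) (E : Set ℝ) (hE : E ⊆ Icc A B) :
    ∃ S : Finset ℝ, (↑S : Set ℝ) ⊆ E ∧ Packing S r ∧ ∀ x ∈ E, ∃ c ∈ S, x ∈ closedBall c (2 * r) := by
  obtain ⟨T, hT⟩ := exists_cover A B r hr
  classical
  let Q : ℕ → Prop := fun n => ∃ S : Finset ℝ, (↑S : Set ℝ) ⊆ E ∧ Packing S r ∧ S.card = n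
  have hQ0 : Q 0 := ⟨∅, by simp, by simp [Packing], by simp⟩
  have hmax : Q (Nat.findGreatest Q T.card) := Nat.findGreatest_spec (Nat.zero_le _) hQ0
  obtain ⟨S, hSE, hSp, hSc⟩ := hmax
  refine ⟨S, hSE, hSp, fun x hx => ?_⟩
  by_contra hno
  push Not at hno
  have hxS : x ∉ S := fun h => hno x h (by simp; linarith)
  have hdis : ∀ c ∈ S, Disjoint (closedBall x r) (closedBall c r) := by
    intro c hc
    apply closedBall_disjoint_closedBall
    have := hno c hc
    rw [mem_closedBall] at this
    linarith
  have hQ : Q (S.card + 1) := by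
    refine ⟨insert x S, ?_, ?_, Finset.card_insert_of_notMem hxS⟩
    · rw [Finset.coe_insert]; exact Set.insert_subset hx hSE
    · unfold Packing
      rw [Finset.coe_insert]
      refine Set.Pairwise.insert hSp fun c hc _ => ⟨hdis c hc, (hdis c hc).symm⟩
  have hle : S.card + 1 ≤ T.card := by
    obtain ⟨S', h1, h2, h3⟩ := hQ
    rw [← h3]
    exact packing_card_le S' T r h2 ((h1.trans hE).trans hT)
  have := Nat.le_findGreatest hle hQ
  omega

lemma oscPow_nonneg (x q : ℝ) (hx : 0 ≤ x) : 0 ≤ oscPow x q := by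
  unfold oscPow; split_ifs
  · rfl
  · exact Real.rpow_nonneg hx _

lemma oscPow_pos (x q : ℝ) (hx : 0 < x) : oscPow x q = x ^ q := by
  unfold oscPow; rw [if_neg hx.ne']

lemma osc_closed_pos (A B : ℝ) (hAB : A < B) (f : ℝ → ℝ) (hmeas : Measurable f)
    (C : ℝ) (hC : ∀ t ∈ Icc A B, |f t| ≤ C) (m : ℕ) (hm : 1 ≤ m) (t : ℝ)
    (ht : t ∈ suppDeriv f (Icc A B) m) (r : ℝ) (hr : 0 < r) :
    0 < osc f m (closedBall t r ∩ Icc A B) :=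
  (osc_pos A B hAB f hmeas C hC m hm t ht r hr).trans_le
    (osc_mono f m _ _ C (fun x hx => hC x hx.2)
      (inter_subset_inter_left _ ball_subset_closedBall))

lemma supp_sub (f : ℝ → ℝ) (I : Set ℝ) (m : ℕ) : suppDeriv f I m ⊆ I := fun _ h => h.1

lemma oscPow_unif (A B : ℝ) (hAB : A < B) (f : ℝ → ℝ) (hmeas : Measurable f)
    (C : ℝ) (hC : ∀ t ∈ Icc A B, |f t| ≤ C) (m : ℕ) (hm : 1 ≤ m) (q : ℝ) (r : ℝ) (hr : 0 < r) :
    ∃ M : ℝ, 0 ≤ M ∧ ∀ t ∈ suppDeriv f (Icc A B) m,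
      oscPow (osc f m (closedBall t r ∩ Icc A B)) q ≤ M := by
  have hC0 : 0 ≤ C := (abs_nonneg _).trans (hC A ⟨le_rfl, hAB.le⟩)
  rcases le_or_gt 0 q with hq | hq
  · refine ⟨(2 ^ m * C) ^ q, by positivity, fun t ht => ?_⟩
    rw [oscPow_pos _ _ (osc_closed_pos A B hAB f hmeas C hC m hm t ht r hr)]
    exact Real.rpow_le_rpow (osc_nonneg _ _ _) (osc_le f m _ C hC0 fun x hx => hC x hx.2) hq
  · obtain ⟨S, hSK, -, hcov⟩ := exists_max_packing A B (r/4) (by linarith)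
      (suppDeriv f (Icc A B) m) (supp_sub _ _ _)
    refine ⟨∑ c ∈ S, (osc f m (ball c (r/2) ∩ Icc A B)) ^ q,
      Finset.sum_nonneg fun c _ => Real.rpow_nonneg (osc_nonneg _ _ _) _, fun t ht => ?_⟩
    rw [oscPow_pos _ _ (osc_closed_pos A B hAB f hmeas C hC m hm t ht r hr)]
    obtain ⟨c, hc, htc⟩ := hcov t ht
    refine le_trans ?_ (Finset.single_le_sum
      (f := fun c => (osc f m (ball c (r/2) ∩ Icc A B)) ^ q)
      (fun c _ => Real.rpow_nonneg (osc_nonneg _ _ _) _) hc)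
    refine Real.rpow_le_rpow_of_nonpos
      (osc_pos A B hAB f hmeas C hC m hm c (hSK hc) (r/2) (by linarith)) ?_ hq.le
    refine osc_mono f m _ _ C (fun x hx => hC x hx.2) (inter_subset_inter_left _ ?_)
    intro x hx
    rw [mem_ball] at hx
    rw [mem_closedBall, dist_comm] at htc
    rw [mem_closedBall]
    linarith [dist_triangle x c t]

lemma packSup_bdd (A B : ℝ) (hAB : A < B) (f : ℝ → ℝ) (hmeas : Measurable f)
    (C : ℝ) (hC : ∀ t ∈ Icc A B, |f t| ≤ C) (m : ℕ) (hm : 1 ≤ m) (q : ℝ) (r : ℝ) (hr : 0 < r) :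
    BddAbove {x : ℝ | ∃ S : Finset ℝ, (↑S : Set ℝ) ⊆ suppDeriv f (Icc A B) m ∧
    (↑S : Set ℝ).Pairwise (fun c c' => Disjoint (closedBall c r) (closedBall c' r)) ∧
    x = ∑ c ∈ S, oscPow (osc f m (closedBall c r ∩ Icc A B)) q} := by
  obtain ⟨M, hM0, hM⟩ := oscPow_unif A B hAB f hmeas C hC m hm q r hr
  obtain ⟨T, hT⟩ := exists_cover A B r hr
  refine ⟨T.card * M, ?_⟩
  rintro x ⟨S, hS, hp, rfl⟩
  calc _ ≤ ∑ c ∈ S, M := Finset.sum_le_sum fun c hc => hM c (hS hc)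
    _ = S.card * M := by simp
    _ ≤ _ := by
      have hc := packing_card_le S T r hp ((hS.trans (supp_sub _ _ _)).trans hT)
      exact mul_le_mul_of_nonneg_right (by exact_mod_cast hc) hM0

lemma le_packSup (A B : ℝ) (hAB : A < B) (f : ℝ → ℝ) (hmeas : Measurable f)
    (C : ℝ) (hC : ∀ t ∈ Icc A B, |f t| ≤ C) (m : ℕ) (hm : 1 ≤ m) (q : ℝ) (r : ℝ) (hr : 0 < r)
    (S : Finset ℝ) (hS : (↑S : Set ℝ) ⊆ suppDeriv f (Icc A B) m) (hp : Packing S r) :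
    ∑ c ∈ S, oscPow (osc f m (closedBall c r ∩ Icc A B)) q ≤ packSup f m (Icc A B) q r :=
  le_csSup (packSup_bdd A B hAB f hmeas C hC m hm q r hr) ⟨S, hS, hp, rfl⟩

lemma tau_eventually (f : ℝ → ℝ) (m : ℕ) (I : Set ℝ) (q T : ℝ) (hT : (T : EReal) < tauSpec f m I q) :
    ∀ᶠ r in 𝓝[>] (0:ℝ), packSup f m I q r ≤ r ^ T := by
  have h1 := eventually_lt_of_lt_liminf hT
  have h2 : ∀ᶠ r in 𝓝[>] (0:ℝ), r ∈ Ioo (0:ℝ) 1 := Ioo_mem_nhdsGT one_pos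
  filter_upwards [h1, h2] with r hr hr2
  have hlog := Real.log_neg hr2.1 hr2.2
  have hr' : T < Real.log (packSup f m I q r) / Real.log r := by exact_mod_cast hr
  rw [lt_div_iff_of_neg hlog] at hr'
  rcases le_or_gt (packSup f m I q r) 0 with h | h
  · exact h.trans (Real.rpow_nonneg hr2.1.le _)
  · rw [Real.rpow_def_of_pos hr2.1]
    exact (Real.log_le_iff_le_exp h).1 (by linarith)


lemma rho_tendsto : Tendsto (fun n : ℕ => ((1:ℝ)/2) ^ n) atTop (𝓝[>] (0:ℝ)) := by
  rw [tendsto_nhdsWithin_iff]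
  refine ⟨tendsto_pow_atTop_nhds_zero_of_lt_one (by norm_num) (by norm_num), ?_⟩
  exact Eventually.of_forall fun n => by simp

lemma dimH_limsup_le (A B : ℝ) (E : Set ℝ) (En : ℕ → Set ℝ) (hEn : ∀ n, En n ⊆ Icc A B)
    (hlim : ∀ t ∈ E, ∃ᶠ n in atTop, t ∈ En n) (s g : ℝ) (hs : 0 ≤ s) (hg : 0 < g)
    (hcard : ∀ᶠ n : ℕ in atTop, ∀ S : Finset ℝ, (↑S : Set ℝ) ⊆ En n → Packing S ((1/2) ^ n) →
      (S.card : ℝ) * ((1/2 : ℝ) ^ n) ^ s ≤ ((1/2 : ℝ) ^ n) ^ g) :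
    dimH E ≤ ENNReal.ofReal s := by
  have hpos : ∀ n : ℕ, (0:ℝ) < (1/2) ^ n := fun n => by positivity
  choose S hSE hSp hScov using fun n => exists_max_packing A B ((1/2) ^ n) (hpos n) (En n) (hEn n)
  have hd : ∀ n : ℕ, ∀ c : ℝ, ediam (closedBall c (2 * (1/2) ^ n)) ≤ ENNReal.ofReal (4 * (1/2) ^ n) := by
    intro n c
    rw [Real.closedBall_eq_Icc, Real.ediam_Icc]
    apply ENNReal.ofReal_le_ofReal
    linarith [hpos n]
  have hmeas := Measure.hausdorffMeasure_le_liminf_tsum (X := ℝ) (β := ℕ)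
    (ι := fun N => Σ n : ℕ, {x // x ∈ S (n + N)}) s E (l := atTop)
    (fun N => ENNReal.ofReal (4 * (1/2) ^ N)) (by
      have : Tendsto (fun N : ℕ => 4 * ((1:ℝ)/2) ^ N) atTop (𝓝 (4 * 0)) :=
        (tendsto_pow_atTop_nhds_zero_of_lt_one (by norm_num) (by norm_num)).const_mul 4
      have := ENNReal.tendsto_ofReal this
      simpa using this)
    (fun N i => closedBall (i.2 : ℝ) (2 * (1/2) ^ (i.1 + N)))
    (by
      refine Eventually.of_forall fun N i => (hd _ _).trans ?_
      apply ENNReal.ofReal_le_ofReal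
      have : ((1:ℝ)/2) ^ (i.1 + N) ≤ (1/2) ^ N :=
        pow_le_pow_of_le_one (by norm_num) (by norm_num) (by omega)
      linarith)
    (by
      refine Eventually.of_forall fun N t ht => ?_
      obtain ⟨n, hn, htn⟩ := (frequently_atTop.1 (hlim t ht)) N
      obtain ⟨k, rfl⟩ := Nat.exists_eq_add_of_le' hn
      obtain ⟨c, hc, htc⟩ := hScov (k + N) t htn
      exact mem_iUnion.2 ⟨⟨k, ⟨c, hc⟩⟩, htc⟩)
  set M : ℝ≥0∞ := ∑' n : ℕ, ENNReal.ofReal (4 ^ s) * (ENNReal.ofReal ((1/2 : ℝ) ^ g)) ^ n with hM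
  have hlt : ENNReal.ofReal ((1/2 : ℝ) ^ g) < 1 := by
    rw [← ENNReal.ofReal_one]
    exact (ENNReal.ofReal_lt_ofReal_iff one_pos).2
      (Real.rpow_lt_one (by norm_num) (by norm_num) hg)
  have hMtop : M ≠ ⊤ := by
    rw [hM, ENNReal.tsum_mul_left, ENNReal.tsum_geometric]
    refine ENNReal.mul_ne_top ENNReal.ofReal_ne_top (ENNReal.inv_ne_top.2 ?_)
    exact (tsub_pos_of_lt hlt).ne'
  obtain ⟨N0, hN0⟩ := eventually_atTop.1 hcard
  have hbound : ∀ᶠ N : ℕ in atTop, ∑' i : (Σ n : ℕ, {x // x ∈ S (n + N)}),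
      ediam (closedBall (i.2 : ℝ) (2 * (1/2) ^ (i.1 + N))) ^ s ≤ M := by
    filter_upwards [eventually_ge_atTop N0] with N hN
    rw [ENNReal.tsum_sigma']
    apply ENNReal.tsum_le_tsum
    intro n
    have h1 := hN0 (n + N) (by omega) (S (n + N)) (hSE _) (hSp _)
    calc ∑' x : {x // x ∈ S (n + N)}, ediam (closedBall (x : ℝ) (2 * (1/2) ^ (n + N))) ^ s
        ≤ ∑' x : {x // x ∈ S (n + N)}, (ENNReal.ofReal (4 * (1/2) ^ (n + N))) ^ s :=
          ENNReal.tsum_le_tsum fun x => ENNReal.rpow_le_rpow (hd _ _) hs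
      _ = (S (n + N)).card * (ENNReal.ofReal (4 * (1/2) ^ (n + N))) ^ s := by
          rw [tsum_fintype]; simp
      _ = ENNReal.ofReal (4 ^ s) * ENNReal.ofReal ((S (n + N)).card * ((1/2 : ℝ) ^ (n + N)) ^ s) := by
          rw [ENNReal.ofReal_rpow_of_nonneg (by positivity) hs, Real.mul_rpow (by norm_num) (hpos _).le,
            ← ENNReal.ofReal_natCast, ← ENNReal.ofReal_mul (by positivity),
            ← ENNReal.ofReal_mul (by positivity)]
          congr 1; ring
      _ ≤ ENNReal.ofReal (4 ^ s) * ENNReal.ofReal (((1/2 : ℝ) ^ g) ^ n) := by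
          gcongr
          refine h1.trans ?_
          rw [← Real.rpow_natCast, ← Real.rpow_mul (by norm_num), ← Real.rpow_natCast,
            ← Real.rpow_mul (by norm_num)]
          apply Real.rpow_le_rpow_of_exponent_ge (by norm_num) (by norm_num)
          push_cast
          nlinarith [(Nat.cast_nonneg N : (0:ℝ) ≤ N)]
      _ = _ := by rw [ENNReal.ofReal_pow (by positivity)]
  have hfin : μH[s] E ≠ ⊤ := by
    refine ne_top_of_le_ne_top hMtop (hmeas.trans ?_)
    exact liminf_le_of_frequently_le' hbound.frequently
  have := dimH_le_of_hausdorffMeasure_ne_top (s := E) (d := s.toNNReal) (by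
    rwa [Real.coe_toNNReal s hs])
  exact this

lemma core (A B : ℝ) (hAB : A < B) (f : ℝ → ℝ) (hmeas : Measurable f)
    (C : ℝ) (hC : ∀ t ∈ Icc A B, |f t| ≤ C) (m : ℕ) (hm : 1 ≤ m) (q β : ℝ) (E : Set ℝ)
    (hEK : E ⊆ suppDeriv f (Icc A B) m) (hne : E.Nonempty)
    (hfr : ∀ t ∈ E, ∀ δ : ℝ, 0 < δ → ∃ᶠ n : ℕ in atTop, ((1/2 : ℝ) ^ n) ^ (β + δ) ≤
      oscPow (osc f m (closedBall t ((1/2) ^ n) ∩ Icc A B)) q) :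
    ((dimH E : ℝ≥0∞) : EReal) ≤ (β : EReal) - tauSpec f m (Icc A B) q := by
  have hpos : ∀ n : ℕ, (0:ℝ) < (1/2) ^ n := fun n => by positivity
  have hev : ∀ T : ℝ, (T : EReal) < tauSpec f m (Icc A B) q → ∀ᶠ n : ℕ in atTop,
      packSup f m (Icc A B) q ((1/2) ^ n) ≤ ((1/2 : ℝ) ^ n) ^ T := fun T hT =>
    rho_tendsto.eventually (tau_eventually f m (Icc A B) q T hT)
  have hτβ : tauSpec f m (Icc A B) q ≤ β := by
    rw [← EReal.ge_of_forall_gt_iff_ge]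
    intro T hT
    rw [EReal.coe_le_coe_iff]
    refine le_of_forall_pos_le_add fun δ hδ => ?_
    obtain ⟨t, ht⟩ := hne
    obtain ⟨n, ⟨h1, h2⟩, h3⟩ := (((hfr t ht δ hδ).and_eventually (hev T hT)).and_eventually
      (eventually_ge_atTop 1)).exists
    have h4 := le_packSup A B hAB f hmeas C hC m hm q _ (hpos n) {t}
      (by simpa using hEK ht) (by simp [Packing])
    rw [Finset.sum_singleton] at h4
    have h5 := (h1.trans h4).trans h2
    rwa [Real.rpow_le_rpow_left_iff_of_base_lt_one (hpos n)
      (pow_lt_one₀ (by norm_num) (by norm_num) (by omega))] at h5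
  induction hτ : tauSpec f m (Icc A B) q with
  | bot => simp
  | top => rw [hτ] at hτβ; simp at hτβ
  | coe T =>
    rw [hτ] at hτβ hev
    rw [EReal.coe_le_coe_iff] at hτβ
    rw [← EReal.coe_sub, ← EReal.le_of_forall_lt_iff_le]
    intro s hs
    rw [EReal.coe_lt_coe_iff] at hs
    set g := s - (β - T) with hg
    have hg0 : 0 < g := by linarith
    have hs0 : 0 ≤ s := by linarith
    have := dimH_limsup_le A B E (fun n => {t | t ∈ suppDeriv f (Icc A B) m ∧
      ((1/2 : ℝ) ^ n) ^ (β + g/4) ≤ oscPow (osc f m (closedBall t ((1/2) ^ n) ∩ Icc A B)) q})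
      (fun n t ht => supp_sub _ _ _ ht.1) (fun t ht => (hfr t ht (g/4) (by linarith)).mono
        fun n hn => ⟨hEK ht, hn⟩) s (g/2) hs0 (by linarith) (by
        filter_upwards [hev (T - g/4) (by rw [EReal.coe_lt_coe_iff]; linarith)] with n hn S hS hp
        have h1 := (le_packSup A B hAB f hmeas C hC m hm q _ (hpos n) S
          (fun c hc => (hS hc).1) hp).trans hn
        have h2 : (S.card : ℝ) * ((1/2 : ℝ) ^ n) ^ (β + g/4) ≤ ((1/2 : ℝ) ^ n) ^ (T - g/4) := by
          refine le_trans ?_ h1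
          rw [← nsmul_eq_mul]
          exact Finset.card_nsmul_le_sum _ _ _ fun c hc => (hS hc).2
        have e1 : ((1/2 : ℝ) ^ n) ^ s = ((1/2 : ℝ) ^ n) ^ (β + g/4) * ((1/2 : ℝ) ^ n) ^ (s - (β + g/4)) := by
          rw [← Real.rpow_add (hpos n)]; ring_nf
        have e2 : ((1/2 : ℝ) ^ n) ^ (g/2) = ((1/2 : ℝ) ^ n) ^ (T - g/4) * ((1/2 : ℝ) ^ n) ^ (s - (β + g/4)) := by
          rw [← Real.rpow_add (hpos n)]; congr 1; rw [hg]; ring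
        rw [e1, e2, ← mul_assoc]
        exact mul_le_mul_of_nonneg_right h2 (Real.rpow_nonneg (hpos n).le _))
    calc ((dimH E : ℝ≥0∞) : EReal) ≤ ((ENNReal.ofReal s : ℝ≥0∞) : EReal) := by exact_mod_cast this
      _ = s := by rw [EReal.coe_ennreal_ofReal, max_eq_left hs0]


lemma rho_absorb (κ γ : ℝ) (hκ : 0 < κ) (hγ : 0 < γ) :
    ∀ᶠ n : ℕ in atTop, ((1/2 : ℝ) ^ n) ^ γ ≤ κ := by
  have h : Tendsto (fun n : ℕ => ((1/2 : ℝ) ^ γ) ^ n) atTop (𝓝 0) :=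
    tendsto_pow_atTop_nhds_zero_of_lt_one (by positivity)
      (Real.rpow_lt_one (by norm_num) (by norm_num) hγ)
  filter_upwards [h.eventually (gt_mem_nhds hκ)] with n hn
  rw [← Real.rpow_natCast, ← Real.rpow_mul (by norm_num), mul_comm, Real.rpow_mul (by norm_num),
    Real.rpow_natCast]
  exact hn.le

lemma freq_lemma (A B : ℝ) (hAB : A < B) (f : ℝ → ℝ) (hmeas : Measurable f)
    (C : ℝ) (hC : ∀ t ∈ Icc A B, |f t| ≤ C) (m : ℕ) (hm : 1 ≤ m) (q h : ℝ) (hh : 0 ≤ h) (t : ℝ)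
    (ht : t ∈ suppDeriv f (Icc A B) m) (hexp : oscExp f m (Icc A B) t = (h : EReal))
    (δ : ℝ) (hδ : 0 < δ) : ∃ᶠ n : ℕ in atTop, ((1/2 : ℝ) ^ n) ^ (h * q + δ) ≤
      oscPow (osc f m (closedBall t ((1/2) ^ n) ∩ Icc A B)) q := by
  have hpos : ∀ n : ℕ, (0:ℝ) < (1/2) ^ n := fun n => by positivity
  have hopos := fun r hr => osc_pos A B hAB f hmeas C hC m hm t ht r hr
  have hOpos := fun r hr => osc_closed_pos A B hAB f hmeas C hC m hm t ht r hr
  have hmono : ∀ J J' : Set ℝ, J ⊆ J' → osc f m (J ∩ Icc A B) ≤ osc f m (J' ∩ Icc A B) :=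
    fun J J' hJ => osc_mono f m _ _ C (fun x hx => hC x hx.2) (inter_subset_inter_left _ hJ)
  have h01 : ∀ᶠ r in 𝓝[>] (0:ℝ), r ∈ Ioo (0:ℝ) 1 := Ioo_mem_nhdsGT one_pos
  set ε := δ / (2 * (|q| + 1)) with hε
  have hεpos : 0 < ε := by positivity
  have hεq : ε * |q| ≤ δ / 2 := by
    rw [hε, div_mul_eq_mul_div, div_le_iff₀ (by positivity)]
    nlinarith [abs_nonneg q]
  have habs := rho_absorb ((2:ℝ) ^ (-((h + ε) * |q|))) (δ/2) (by positivity) (by linarith)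
  rcases le_or_gt 0 q with hq | hq
  · rw [abs_of_nonneg hq] at hεq habs
    have h1 : ∃ᶠ r in 𝓝[>] (0:ℝ), ((Real.log (osc f m (ball t r ∩ Icc A B)) / Real.log r : ℝ) : EReal)
        < ((h + ε : ℝ) : EReal) := by
      apply frequently_lt_of_liminf_lt
      · isBoundedDefault
      change oscExp f m (Icc A B) t < _
      rw [hexp, EReal.coe_lt_coe_iff]; linarith
    obtain ⟨N1, hN1⟩ := eventually_atTop.1 habs
    rw [frequently_atTop]
    intro N
    have h2 : ∀ᶠ r in 𝓝[>] (0:ℝ), r ∈ Ioo (0:ℝ) ((1/2) ^ (max N N1)) := Ioo_mem_nhdsGT (hpos _)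
    obtain ⟨r, ⟨hr, hr01⟩, hrN⟩ := ((h1.and_eventually h01).and_eventually h2).exists
    rw [EReal.coe_lt_coe_iff, div_lt_iff_of_neg (Real.log_neg hr01.1 hr01.2)] at hr
    have hr' : r ^ (h + ε) ≤ osc f m (ball t r ∩ Icc A B) := by
      rw [Real.rpow_def_of_pos hr01.1]
      exact ((Real.lt_log_iff_exp_lt (hopos r hr01.1)).1 (by linarith)).le
    obtain ⟨n, hn1, hn2⟩ := exists_nat_pow_near_of_lt_one hr01.1 hr01.2.le
      (show (0:ℝ) < 1/2 by norm_num) (by norm_num)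
    have hnN : max N N1 ≤ n := by
      have := hn1.trans hrN.2
      rw [pow_lt_pow_iff_right_of_lt_one₀ (by norm_num) (by norm_num)] at this
      omega
    refine ⟨n, (le_max_left _ _).trans hnN, ?_⟩
    have ha := hN1 n ((le_max_right _ _).trans hnN)
    rw [oscPow_pos _ _ (hOpos _ (hpos n))]
    have hO : ((1/2 : ℝ) ^ n / 2) ^ (h + ε) ≤ osc f m (closedBall t ((1/2) ^ n) ∩ Icc A B) := by
      refine le_trans ?_ (hr'.trans (hmono _ _ ?_))
      · apply Real.rpow_le_rpow (by positivity) _ (by linarith)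
        rw [pow_succ] at hn1; linarith
      · exact (ball_subset_ball hn2).trans ball_subset_closedBall
    calc ((1/2 : ℝ) ^ n) ^ (h * q + δ)
        ≤ ((1/2 : ℝ) ^ n) ^ ((h + ε) * q + δ / 2) := by
          apply Real.rpow_le_rpow_of_exponent_ge (hpos n) (pow_le_one₀ (by norm_num) (by norm_num))
          linarith
      _ = ((1/2 : ℝ) ^ n) ^ ((h + ε) * q) * ((1/2 : ℝ) ^ n) ^ (δ / 2) := Real.rpow_add (hpos n) _ _
      _ ≤ ((1/2 : ℝ) ^ n) ^ ((h + ε) * q) * (2:ℝ) ^ (-((h + ε) * q)) := by gcongr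
      _ = ((1/2 : ℝ) ^ n / 2) ^ ((h + ε) * q) := by
          rw [Real.div_rpow (hpos n).le (by norm_num), Real.rpow_neg (by norm_num)]; rfl
      _ = (((1/2 : ℝ) ^ n / 2) ^ (h + ε)) ^ q := Real.rpow_mul (by positivity) _ _
      _ ≤ _ := Real.rpow_le_rpow (by positivity) hO hq
  · rw [abs_of_neg hq] at hεq habs
    have h1 : ∀ᶠ r in 𝓝[>] (0:ℝ), ((h - ε : ℝ) : EReal) <
        ((Real.log (osc f m (ball t r ∩ Icc A B)) / Real.log r : ℝ) : EReal) := by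
      refine eventually_lt_of_lt_liminf ?_
      change _ < oscExp f m (Icc A B) t
      rw [hexp, EReal.coe_lt_coe_iff]; linarith
    have htend : Tendsto (fun n : ℕ => 2 * ((1:ℝ)/2) ^ n) atTop (𝓝[>] (0:ℝ)) := by
      rw [tendsto_nhdsWithin_iff]
      refine ⟨?_, Eventually.of_forall fun n => by simp⟩
      have := (tendsto_pow_atTop_nhds_zero_of_lt_one (r := (1:ℝ)/2) (by norm_num) (by norm_num)).const_mul 2
      simpa using this
    apply Eventually.frequently
    filter_upwards [htend.eventually (h1.and h01), habs] with n hn ha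
    obtain ⟨hr, hr01⟩ := hn
    rw [EReal.coe_lt_coe_iff, lt_div_iff_of_neg (Real.log_neg hr01.1 hr01.2)] at hr
    have hr' : osc f m (ball t (2 * (1/2) ^ n) ∩ Icc A B) ≤ (2 * (1/2 : ℝ) ^ n) ^ (h - ε) := by
      rw [Real.rpow_def_of_pos hr01.1]
      exact (Real.log_le_iff_le_exp (hopos _ hr01.1)).1 (by linarith)
    rw [oscPow_pos _ _ (hOpos _ (hpos n))]
    have hO : osc f m (closedBall t ((1/2) ^ n) ∩ Icc A B) ≤ (2 * (1/2 : ℝ) ^ n) ^ (h - ε) :=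
      (hmono _ _ (closedBall_subset_ball (by linarith [hpos n]))).trans hr'
    calc ((1/2 : ℝ) ^ n) ^ (h * q + δ)
        ≤ ((1/2 : ℝ) ^ n) ^ ((h - ε) * q + δ / 2) := by
          apply Real.rpow_le_rpow_of_exponent_ge (hpos n) (pow_le_one₀ (by norm_num) (by norm_num))
          linarith
      _ = ((1/2 : ℝ) ^ n) ^ ((h - ε) * q) * ((1/2 : ℝ) ^ n) ^ (δ / 2) := Real.rpow_add (hpos n) _ _
      _ ≤ ((1/2 : ℝ) ^ n) ^ ((h - ε) * q) * (2:ℝ) ^ (-((h + ε) * (-q))) := by gcongr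
      _ ≤ ((1/2 : ℝ) ^ n) ^ ((h - ε) * q) * (2:ℝ) ^ ((h - ε) * q) := by
          gcongr
          · norm_num
          · nlinarith
      _ = (2 * (1/2 : ℝ) ^ n) ^ ((h - ε) * q) := by
          rw [Real.mul_rpow (by norm_num) (hpos n).le, mul_comm]
      _ = ((2 * (1/2 : ℝ) ^ n) ^ (h - ε)) ^ q := Real.rpow_mul (by positivity) _ _
      _ ≤ _ := Real.rpow_le_rpow_of_nonpos (hOpos _ (hpos n)) hO hq.le


lemma sum_zero (A B : ℝ) (hAB : A < B) (f : ℝ → ℝ) (hmeas : Measurable f)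
    (C : ℝ) (hC : ∀ t ∈ Icc A B, |f t| ≤ C) (m : ℕ) (hm : 1 ≤ m) (r : ℝ) (hr : 0 < r)
    (S : Finset ℝ) (hS : (↑S : Set ℝ) ⊆ suppDeriv f (Icc A B) m) :
    ∑ c ∈ S, oscPow (osc f m (closedBall c r ∩ Icc A B)) 0 = S.card := by
  rw [Finset.sum_congr rfl (g := fun _ => (1:ℝ))]
  · simp
  · intro c hc
    rw [oscPow_pos _ _ (osc_closed_pos A B hAB f hmeas C hC m hm c (hS hc) r hr), Real.rpow_zero]

lemma pack_le_cover (A B : ℝ) (hAB : A < B) (f : ℝ → ℝ) (hmeas : Measurable f)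
    (C : ℝ) (hC : ∀ t ∈ Icc A B, |f t| ≤ C) (m : ℕ) (hm : 1 ≤ m) (r : ℝ) (hr : 0 < r) :
    packSup f m (Icc A B) 0 r ≤ coverNum (suppDeriv f (Icc A B) m) r := by
  refine Real.sSup_le ?_ (Nat.cast_nonneg _)
  rintro x ⟨S, hS, hp, rfl⟩
  rw [sum_zero A B hAB f hmeas C hC m hm r hr S hS]
  have hne : {n : ℕ | ∃ T : Finset ℝ, T.card = n ∧ suppDeriv f (Icc A B) m ⊆ ⋃ c ∈ T, ball c r}.Nonempty := by
    obtain ⟨T, hT⟩ := exists_cover A B r hr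
    exact ⟨_, T, rfl, (supp_sub _ _ _).trans hT⟩
  obtain ⟨T, hTc, hT⟩ := Nat.sInf_mem hne
  have := packing_card_le S T r hp (hS.trans hT)
  rw [hTc] at this
  exact_mod_cast this

lemma cover_le_pack (A B : ℝ) (hAB : A < B) (f : ℝ → ℝ) (hmeas : Measurable f)
    (C : ℝ) (hC : ∀ t ∈ Icc A B, |f t| ≤ C) (m : ℕ) (hm : 1 ≤ m) (r : ℝ) (hr : 0 < r) :
    (coverNum (suppDeriv f (Icc A B) m) r : ℝ) ≤ packSup f m (Icc A B) 0 (r / 3) := by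
  have hr3 : 0 < r / 3 := by linarith
  obtain ⟨S, hSK, hp, hcov⟩ := exists_max_packing A B (r/3) hr3
      (suppDeriv f (Icc A B) m) (supp_sub _ _ _)
  refine le_trans ?_ (le_packSup A B hAB f hmeas C hC m hm 0 (r/3) hr3 S hSK hp)
  rw [sum_zero A B hAB f hmeas C hC m hm _ hr3 S hSK]
  have : coverNum (suppDeriv f (Icc A B) m) r ≤ S.card := by
    refine Nat.sInf_le ⟨S, rfl, fun x hx => ?_⟩
    obtain ⟨c, hc, hxc⟩ := hcov x hx
    refine mem_iUnion₂.2 ⟨c, hc, ?_⟩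
    rw [mem_closedBall] at hxc
    rw [mem_ball]; linarith
  exact_mod_cast this

lemma one_le_pack (A B : ℝ) (hAB : A < B) (f : ℝ → ℝ) (hmeas : Measurable f)
    (C : ℝ) (hC : ∀ t ∈ Icc A B, |f t| ≤ C) (m : ℕ) (hm : 1 ≤ m)
    (hsupp : (suppDeriv f (Icc A B) m).Nonempty) (r : ℝ) (hr : 0 < r) :
    1 ≤ packSup f m (Icc A B) 0 r := by
  obtain ⟨t, ht⟩ := hsupp
  have h1 : ((({t} : Finset ℝ)) : Set ℝ) ⊆ suppDeriv f (Icc A B) m := by simpa using ht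
  have := le_packSup A B hAB f hmeas C hC m hm 0 r hr {t} h1 (by simp [Packing])
  rw [sum_zero A B hAB f hmeas C hC m hm r hr _ h1] at this
  simpa using this

lemma box_eq (A B : ℝ) (hAB : A < B) (f : ℝ → ℝ) (hmeas : Measurable f)
    (C : ℝ) (hC : ∀ t ∈ Icc A B, |f t| ≤ C) (m : ℕ) (hm : 1 ≤ m)
    (hsupp : (suppDeriv f (Icc A B) m).Nonempty) :
    upperBoxDim (suppDeriv f (Icc A B) m) = - tauSpec f m (Icc A B) 0 := by
  have h01 : ∀ᶠ r in 𝓝[>] (0:ℝ), r ∈ Ioo (0:ℝ) 1 := Ioo_mem_nhdsGT one_pos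
  have h1P := fun r hr => one_le_pack A B hAB f hmeas C hC m hm hsupp r hr
  apply le_antisymm
  · rw [← EReal.le_of_forall_lt_iff_le]
    intro s hs
    rw [← EReal.le_of_forall_lt_iff_le]
    intro s' hs'
    rw [EReal.coe_lt_coe_iff] at hs'
    have hs2 : ((-s : ℝ) : EReal) < tauSpec f m (Icc A B) 0 := by
      rw [EReal.coe_neg]; exact EReal.neg_lt_comm.1 hs
    have h3 : Tendsto (fun r : ℝ => r / 3) (𝓝[>] (0:ℝ)) (𝓝[>] (0:ℝ)) := by
      rw [tendsto_nhdsWithin_iff]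
      constructor
      · have : Tendsto (fun r : ℝ => r / 3) (𝓝 0) (𝓝 (0 / 3)) := tendsto_id.div_const 3
        rw [zero_div] at this
        exact this.mono_left nhdsWithin_le_nhds
      · filter_upwards [h01] with r hr
        exact div_pos hr.1 (by norm_num)
    have h4 := h3.eventually (tau_eventually f m (Icc A B) 0 (-s) hs2)
    have h5 : ∀ᶠ r in 𝓝[>] (0:ℝ), s * Real.log 3 ≤ (s' - s) * Real.log (1 / r) := by
      have : Tendsto (fun r : ℝ => (s' - s) * Real.log (1 / r)) (𝓝[>] (0:ℝ)) atTop := by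
        apply Tendsto.const_mul_atTop (by linarith)
        apply Real.tendsto_log_atTop.comp
        have h6 := tendsto_inv_nhdsGT_zero (𝕜 := ℝ)
        simp only [← one_div] at h6
        exact h6
      exact this.eventually_ge_atTop _
    apply limsup_le_of_le
    · isBoundedDefault
    filter_upwards [h01, h4, h5] with r hr hr4 hr5
    rw [EReal.coe_le_coe_iff]
    have hlog := Real.log_neg hr.1 hr.2
    have hl : Real.log (1 / r) = - Real.log r := by rw [one_div, Real.log_inv]
    rw [hl] at hr5 ⊢
    rw [div_le_iff₀ (by linarith)]
    have hN1 : (1:ℝ) ≤ coverNum (suppDeriv f (Icc A B) m) r :=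
      (h1P r hr.1).trans (pack_le_cover A B hAB f hmeas C hC m hm r hr.1)
    have hN := (cover_le_pack A B hAB f hmeas C hC m hm r hr.1).trans hr4
    have := Real.log_le_log (by linarith) hN
    rw [Real.log_rpow (div_pos hr.1 (by norm_num)), Real.log_div hr.1.ne' (by norm_num)] at this
    nlinarith
  · unfold tauSpec upperBoxDim
    rw [← EReal.limsup_neg]
    apply limsup_le_limsup
    · filter_upwards [h01] with r hr
      rw [Pi.neg_apply, ← EReal.coe_neg, EReal.coe_le_coe_iff]
      have hlog := Real.log_neg hr.1 hr.2
      have hl : Real.log (1 / r) = - Real.log r := by rw [one_div, Real.log_inv]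
      rw [hl, ← div_neg]
      apply div_le_div_of_nonneg_right _ (by linarith)
      apply Real.log_le_log (by linarith [h1P r hr.1])
      exact pack_le_cover A B hAB f hmeas C hC m hm r hr.1
    · isBoundedDefault
    · isBoundedDefault

/-- For a bounded measurable `f : I → ℝ` and `m ≥ 1` with
`supp(f^{(m)}) ≠ ∅`: for every `h ≥ 0`,
`dim_H E^{(m)}_f(h) ≤ (τ^{(m)}_f)^*(h)` (a negative right-hand side meaning the level set is
empty, with `dim_H ∅ = -∞`), and
`dim_H supp(f^{(m)}) ≤ upper box dimension of supp(f^{(m)}) = -τ^{(m)}_f(0)`. -/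
theorem statement2 (A B : ℝ) (hAB : A < B) (f : ℝ → ℝ) (hmeas : Measurable f)
    (hbdd : ∃ C : ℝ, ∀ t ∈ Icc A B, |f t| ≤ C) (m : ℕ) (hm : 1 ≤ m)
    (hsupp : (suppDeriv f (Icc A B) m).Nonempty) :
    (∀ h : ℝ, 0 ≤ h →
      dimHE {t ∈ suppDeriv f (Icc A B) m | oscExp f m (Icc A B) t = (h : EReal)}
        ≤ legendre (tauSpec f m (Icc A B)) h) ∧
    ((dimH (suppDeriv f (Icc A B) m) : ℝ≥0∞) : EReal) ≤ upperBoxDim (suppDeriv f (Icc A B) m) ∧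
    upperBoxDim (suppDeriv f (Icc A B) m) = - tauSpec f m (Icc A B) 0 := by
  obtain ⟨C, hC⟩ := hbdd
  have hbox := box_eq A B hAB f hmeas C hC m hm hsupp
  refine ⟨fun h hh => ?_, ?_, hbox⟩
  · unfold dimHE
    split_ifs with hE
    · exact bot_le
    · refine le_iInf fun q => ?_
      exact core A B hAB f hmeas C hC m hm q (h * q) _ (fun t ht => ht.1)
        (Set.nonempty_iff_ne_empty.2 hE) (fun t ht δ hδ =>
          freq_lemma A B hAB f hmeas C hC m hm q h hh t ht.1 ht.2 δ hδ)
  · rw [hbox]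
    have := core A B hAB f hmeas C hC m hm 0 0 _ subset_rfl hsupp (fun t ht δ hδ => by
      refine Frequently.of_forall fun n => ?_
      have hpos : (0:ℝ) < (1/2) ^ n := by positivity
      rw [oscPow_pos _ _ (osc_closed_pos A B hAB f hmeas C hC m hm t ht _ hpos), Real.rpow_zero]
      exact Real.rpow_le_one hpos.le (pow_le_one₀ (by norm_num) (by norm_num)) (by linarith))
    simpa using this
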